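/- Let p be an odd prime and q = p^a with q ≡ 3 (mod 4), and let K = 𝔽_q((u)) with its u-adic valuation topology. Then there exist finite subgroups A₁, A₂ of SL₂(K), each of order 2(q+1) and containing -I, with A_i/⟨-I⟩ isomorphic to the dihedral group of order q+1 for i = 1,2, such that A₁ ∩ A₂ = {I, -I} and the subgroup Γ of SL₂(K) generated by A₁ ∪ A₂ is discrete and cocompact. -/

import Mathlib

instance : Fact (Even (Fintype.card (Fin 2))) := ⟨⟨1, rfl⟩⟩

/-- `SL₂` over a topological field carries the subspace topology induced from the
entrywise topology on `2 × 2` matrices. -/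
noncomputable instance SL2.topologicalSpace (K : Type*) [Field K] [TopologicalSpace K] :
    TopologicalSpace (Matrix.SpecialLinearGroup (Fin 2) K) :=
  TopologicalSpace.induced
    (fun g => (↑g : Matrix (Fin 2) (Fin 2) K)) inferInstance

/-- A group in which `ρ` of order `m` generates an index two subgroup inverted by the
involution `σ` is dihedral. -/
theorem Subgroup.nonempty_mulEquiv_dihedralGroup {H : Type*} [Group H] (S : Subgroup H) {m : ℕ}
    {ρ σ : H} (hρS : ρ ∈ S) (hσS : σ ∈ S) (hρ : orderOf ρ = m) (hσ : σ * σ = 1)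
    (hinv : ∀ i : ℤ, ρ ^ i * σ = σ * ρ ^ (-i)) (hnot : σ ∉ Subgroup.zpowers ρ)
    (hS : ∀ x ∈ S, x ∈ Subgroup.zpowers ρ ∨ σ * x ∈ Subgroup.zpowers ρ) :
    Nonempty (S ≃* DihedralGroup m) := by
  have hρm : zmultiplesHom (Additive H) (Additive.ofMul ρ) (m : ℤ) = 0 := by
    simp [← ofMul_pow, ← hρ, pow_orderOf_eq_one]
  let e : ZMod m →+ Additive H := ZMod.lift m ⟨zmultiplesHom (Additive H) (Additive.ofMul ρ), hρm⟩
  have he (i : ℤ) : (e i).toMul = ρ ^ i := by simp [e]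
  have heinj : Function.Injective e := by
    refine (ZMod.lift_injective _).2 fun i hi => ?_
    have hi' : ρ ^ i = 1 := by simpa [← ofMul_zpow] using hi
    rw [ZMod.intCast_zmod_eq_zero_iff_dvd, ← hρ]
    exact orderOf_dvd_iff_zpow_eq_one.2 hi'
  have hadd (i j : ZMod m) : (e (i + j)).toMul = (e i).toMul * (e j).toMul := by simp
  have hcomm (i : ZMod m) : (e i).toMul * σ = σ * (e (-i)).toMul := by
    obtain ⟨i, rfl⟩ := ZMod.intCast_surjective i
    rw [← Int.cast_neg, he, he, hinv]
  have hmem (i : ZMod m) : (e i).toMul ∈ Subgroup.zpowers ρ := by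
    obtain ⟨i, rfl⟩ := ZMod.intCast_surjective i
    exact ⟨i, (he i).symm⟩
  have hle : Subgroup.zpowers ρ ≤ S := by simpa using hρS
  let f : DihedralGroup m →* H := MonoidHom.mk'
    (fun x => match x with
      | .r i => (e i).toMul
      | .sr i => σ * (e i).toMul) (by
    rintro (i | i) (j | j)
    · exact hadd i j
    · change σ * (e (j - i)).toMul = (e i).toMul * (σ * (e j).toMul)
      rw [← mul_assoc, hcomm, mul_assoc, ← hadd, neg_add_eq_sub]
    · change σ * (e (i + j)).toMul = σ * (e i).toMul * (e j).toMul
      rw [hadd, mul_assoc]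
    · change (e (j - i)).toMul = σ * (e i).toMul * (σ * (e j).toMul)
      rw [mul_assoc, ← mul_assoc _ σ, hcomm, mul_assoc, ← mul_assoc σ σ, hσ, one_mul, ← hadd,
        neg_add_eq_sub])
  have hfS (x : DihedralGroup m) : f x ∈ S := by
    rcases x with i | i
    · exact hle (hmem i)
    · exact S.mul_mem hσS (hle (hmem i))
  refine ⟨(MulEquiv.ofBijective (f.codRestrict S hfS) ⟨?_, ?_⟩).symm⟩
  · rw [injective_iff_map_eq_one]
    rintro (i | i) hi
    · have hi' : (e i).toMul = 1 := congrArg Subtype.val hi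
      have : i = 0 := heinj (by rw [map_zero]; exact hi')
      rw [this, DihedralGroup.one_def]
    · have hi' : σ * (e i).toMul = 1 := congrArg Subtype.val hi
      rw [eq_inv_of_mul_eq_one_left hi'] at hnot
      exact absurd (inv_mem (hmem i)) hnot
  · rintro ⟨x, hx⟩
    rcases hS x hx with ⟨i, hi⟩ | ⟨i, hi⟩
    · exact ⟨.r i, Subtype.ext ((he i).trans hi)⟩
    · refine ⟨.sr i, Subtype.ext ?_⟩
      change σ * (e i).toMul = x
      rw [he]
      simp only at hi
      rw [hi, ← mul_assoc, hσ, one_mul]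

section NormTorus

open Matrix

theorem SL2_mul_apply {R : Type*} [CommRing R] (g h : Matrix.SpecialLinearGroup (Fin 2) R)
    (i j : Fin 2) : (g * h) i j = g i 0 * h 0 j + g i 1 * h 1 j := by
  rw [Matrix.SpecialLinearGroup.coe_mul, mul_apply, Fin.sum_univ_two]

theorem SL2_inv_eq {R : Type*} [CommRing R] (g : Matrix.SpecialLinearGroup (Fin 2) R) :
    g⁻¹ 0 0 = g 1 1 ∧ g⁻¹ 0 1 = -g 0 1 ∧ g⁻¹ 1 0 = -g 1 0 ∧ g⁻¹ 1 1 = g 0 0 := by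
  simp [Matrix.SpecialLinearGroup.SL2_inv_expl]

variable (k : Type*) [Field k]

/-- The matrices of determinant one of the form `!![a, b; -b, a]`. -/
def normTorus : Subgroup (Matrix.SpecialLinearGroup (Fin 2) k) where
  carrier := {g | g 1 1 = g 0 0 ∧ g 1 0 = -g 0 1}
  one_mem' := by simp
  mul_mem' := by
    rintro g h ⟨h₁, h₂⟩ ⟨h₃, h₄⟩
    simp only [Set.mem_ofPred_eq, SL2_mul_apply, h₁, h₂, h₃, h₄]
    constructor <;> ring
  inv_mem' := by
    rintro g ⟨h₁, h₂⟩
    obtain ⟨e₁, e₂, e₃, e₄⟩ := SL2_inv_eq g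
    simp [e₁, e₂, e₃, e₄, h₁, h₂]

/-- The matrices of determinant one of the form `!![a, b; -b, a]` or `!![c, d; d, -c]`. If `-1`
is not a square in `k`, this is the normalizer of the nonsplit torus `normTorus k`. -/
def torusNormalizer : Subgroup (Matrix.SpecialLinearGroup (Fin 2) k) where
  carrier := {g | g 1 1 = g 0 0 ∧ g 1 0 = -g 0 1 ∨ g 1 1 = -g 0 0 ∧ g 1 0 = g 0 1}
  one_mem' := by simp
  mul_mem' := by
    rintro g h (⟨h₁, h₂⟩ | ⟨h₁, h₂⟩) (⟨h₃, h₄⟩ | ⟨h₃, h₄⟩) <;>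
    simp only [Set.mem_ofPred_eq, SL2_mul_apply, h₁, h₂, h₃, h₄]
    · left; constructor <;> ring
    · right; constructor <;> ring
    · right; constructor <;> ring
    · left; constructor <;> ring
  inv_mem' := by
    rintro g (⟨h₁, h₂⟩ | ⟨h₁, h₂⟩) <;> obtain ⟨e₁, e₂, e₃, e₄⟩ := SL2_inv_eq g <;>
    simp [e₁, e₂, e₃, e₄, h₁, h₂]

variable {k}

theorem SL2_det_eq (g : Matrix.SpecialLinearGroup (Fin 2) k) :
    g 0 0 * g 1 1 - g 0 1 * g 1 0 = 1 := by
  rw [← det_fin_two]; exact g.2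

theorem mem_normTorus {g : Matrix.SpecialLinearGroup (Fin 2) k} :
    g ∈ normTorus k ↔ g 1 1 = g 0 0 ∧ g 1 0 = -g 0 1 := Iff.rfl

theorem normTorus_le_torusNormalizer : normTorus k ≤ torusNormalizer k := fun _ h => Or.inl h

theorem neg_one_mem_normTorus : (-1 : Matrix.SpecialLinearGroup (Fin 2) k) ∈ normTorus k := by
  simp [mem_normTorus]

theorem SL2_eq_of_entries {g h : Matrix.SpecialLinearGroup (Fin 2) k} (h₀₀ : g 0 0 = h 0 0)
    (h₀₁ : g 0 1 = h 0 1) (h₁₀ : g 1 0 = h 1 0) (h₁₁ : g 1 1 = h 1 1) : g = h := by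
  ext i j
  fin_cases i <;> fin_cases j <;> assumption

theorem torusNormalizer_apply_one_zero_eq_zero_iff {g : Matrix.SpecialLinearGroup (Fin 2) k}
    (hg : g ∈ torusNormalizer k) : g 1 0 = 0 ↔ g 0 1 = 0 := by
  rcases hg with ⟨-, h⟩ | ⟨-, h⟩ <;> simp [h]

theorem eq_one_or_neg_one_of_mem_torusNormalizer (hk : ¬IsSquare (-1 : k))
    {g : Matrix.SpecialLinearGroup (Fin 2) k} (hg : g ∈ torusNormalizer k) (h : g 0 1 = 0) :
    g = 1 ∨ g = -1 := by
  have hdet := SL2_det_eq g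
  rcases hg with ⟨h₁, h₂⟩ | ⟨h₁, h₂⟩
  · have : (g 0 0 - 1) * (g 0 0 + 1) = 0 := by rw [h₁, h] at hdet; linear_combination hdet
    rcases mul_eq_zero.1 this with h' | h'
    · left
      have h₀ : g 0 0 = 1 := by linear_combination h'
      apply SL2_eq_of_entries <;> simp [h₁, h₂, h, h₀]
    · right
      have h₀ : g 0 0 = -1 := by linear_combination h'
      apply SL2_eq_of_entries <;> simp [h₁, h₂, h, h₀]
  · exact absurd ⟨g 0 0, by rw [h₁, h] at hdet; linear_combination hdet⟩ hk

theorem exists_mem_torusNormalizer_proportional [Finite k] (hk : ¬IsSquare (-1 : k)) {s t : k}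
    (hst : s ≠ 0 ∨ t ≠ 0) :
    ∃ g ∈ torusNormalizer k, ∃ c : k, g 0 1 = c * s ∧ g 1 1 = c * t := by
  have := Fintype.ofFinite k
  have hne : s ^ 2 + t ^ 2 ≠ 0 := fun h0 => by
    by_cases ht : t = 0
    · simp_all
    · exact hk ⟨s / t, by field_simp; linear_combination -h0⟩
  have hsq : IsSquare (s ^ 2 + t ^ 2) ∨ IsSquare (-(s ^ 2 + t ^ 2)) := by
    by_contra! hcon
    classical
    have h₁ := (quadraticChar_neg_one_iff_not_isSquare).2 hcon.1
    have h₂ := (quadraticChar_neg_one_iff_not_isSquare).2 hcon.2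
    have h₃ := (quadraticChar_neg_one_iff_not_isSquare).2 hk
    rw [← neg_one_mul, map_mul, h₁, h₃] at h₂
    norm_num at h₂
  rcases hsq with ⟨l, hl⟩ | ⟨l, hl⟩
  · have hl0 : l ≠ 0 := by rintro rfl; exact hne (by linear_combination hl)
    refine ⟨⟨!![t / l, s / l; -(s / l), t / l], ?_⟩, Or.inl ?_, l⁻¹, ?_⟩
    · rw [det_fin_two_of]; field_simp; linear_combination hl
    · simp
    · simp [div_eq_inv_mul]
  · have hl0 : l ≠ 0 := by rintro rfl; exact hne (by linear_combination -hl)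
    refine ⟨⟨!![-(t / l), s / l; s / l, t / l], ?_⟩, Or.inr ?_, l⁻¹, ?_⟩
    · rw [det_fin_two_of]; field_simp; linear_combination hl
    · simp
    · simp [div_eq_inv_mul]

theorem det_conic_point {t : k} (ht : 1 + t ^ 2 ≠ 0) :
    det !![(1 - t ^ 2) / (1 + t ^ 2), 2 * t / (1 + t ^ 2);
      -(2 * t / (1 + t ^ 2)), (1 - t ^ 2) / (1 + t ^ 2)] = 1 := by
  rw [det_fin_two_of]
  field_simp
  ring

/-- The rational parametrization of the conic `a ^ 2 + b ^ 2 = 1`. -/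
theorem card_normTorus [Finite k] (hk : ¬IsSquare (-1 : k)) :
    Nat.card (normTorus k) = Nat.card k + 1 := by
  have h2 : (2 : k) ≠ 0 := fun h => hk ⟨1, by linear_combination -h⟩
  have hne (t : k) : 1 + t ^ 2 ≠ 0 := fun h => hk ⟨t, by linear_combination -h⟩
  let f : Option k → normTorus k := fun o => o.elim ⟨-1, neg_one_mem_normTorus⟩ fun t =>
    ⟨⟨!![(1 - t ^ 2) / (1 + t ^ 2), 2 * t / (1 + t ^ 2);
      -(2 * t / (1 + t ^ 2)), (1 - t ^ 2) / (1 + t ^ 2)], det_conic_point (hne t)⟩, rfl, rfl⟩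
  have hf : Function.Bijective f := by
    have hsome (t : k) : (f (some t)).1 0 0 + 1 = 2 / (1 + t ^ 2) ∧
        (f (some t)).1 0 1 = 2 * t / (1 + t ^ 2) := by
      have := hne t
      refine ⟨?_, by simp [f]⟩
      have h₀ : (f (some t)).1 0 0 = (1 - t ^ 2) / (1 + t ^ 2) := by simp [f]
      rw [h₀, div_add_one this]
      ring
    have hnone : (f none).1 0 0 = -1 := by simp [f]
    constructor
    · rintro (_ | s) (_ | t) hst
      · rfl
      · have := (hsome t).1
        rw [← hst, hnone, neg_add_cancel] at this
        exact absurd this.symm (div_ne_zero h2 (hne t))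
      · have := (hsome s).1
        rw [hst, hnone, neg_add_cancel] at this
        exact absurd this.symm (div_ne_zero h2 (hne s))
      · obtain ⟨h₁, h₂⟩ := hsome s
        obtain ⟨h₃, h₄⟩ := hsome t
        rw [hst] at h₁ h₂
        rw [h₁] at h₃
        rw [h₂] at h₄
        have hs := hne s
        have ht := hne t
        have : s = t := by
          have e₁ : 2 * s / (1 + s ^ 2) = s * (2 / (1 + s ^ 2)) := by ring
          have e₂ : 2 * t / (1 + t ^ 2) = t * (2 / (1 + t ^ 2)) := by ring
          rw [e₁, e₂, h₃] at h₄
          exact mul_right_cancel₀ (div_ne_zero h2 ht) h₄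
        rw [this]
    · rintro ⟨g, hg⟩
      have hdet := SL2_det_eq g
      obtain ⟨h₁, h₂⟩ := hg
      rw [h₁, h₂] at hdet
      by_cases h : g 0 0 = -1
      · refine ⟨none, Subtype.ext ?_⟩
        have h0 : g 0 1 = 0 := by
          rw [h] at hdet
          have : g 0 1 * g 0 1 = 0 := by linear_combination hdet
          simpa using this
        apply SL2_eq_of_entries <;> simp [f, h₁, h₂, h, h0]
      · have ha : 1 + g 0 0 ≠ 0 := fun h' => h (by linear_combination h')
        have hs : 1 + (g 0 1 / (1 + g 0 0)) ^ 2 = 2 / (1 + g 0 0) := by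
          field_simp; linear_combination hdet
        have e₁ : (1 - (g 0 1 / (1 + g 0 0)) ^ 2) / (1 + (g 0 1 / (1 + g 0 0)) ^ 2) = g 0 0 := by
          rw [hs]; field_simp; linear_combination -hdet
        have e₂ : 2 * (g 0 1 / (1 + g 0 0)) / (1 + (g 0 1 / (1 + g 0 0)) ^ 2) = g 0 1 := by
          rw [hs]; field_simp
        refine ⟨some (g 0 1 / (1 + g 0 0)), Subtype.ext ?_⟩
        apply SL2_eq_of_entries <;> simp [f, h₁, h₂, e₁, e₂]
  rw [← Nat.card_congr (Equiv.ofBijective f hf)]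
  exact Finite.card_option

theorem isCyclic_normTorus [Finite k] (hk : ¬IsSquare (-1 : k)) : IsCyclic (normTorus k) := by
  obtain ⟨i, hi⟩ := IsAlgClosed.exists_pow_nat_eq (-1 : AlgebraicClosure k) (n := 2) two_pos
  let F : normTorus k →* AlgebraicClosure k :=
    { toFun := fun g => algebraMap k _ (g.1 0 0) + algebraMap k _ (g.1 0 1) * i
      map_one' := by simp
      map_mul' := by
        intro g h
        change algebraMap k _ ((g.1 * h.1) 0 0) + algebraMap k _ ((g.1 * h.1) 0 1) * i = _
        rw [SL2_mul_apply, SL2_mul_apply, h.2.1, h.2.2]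
        simp only [map_add, map_mul, map_neg]
        linear_combination -algebraMap k (AlgebraicClosure k) (g.1 0 1) *
          algebraMap k (AlgebraicClosure k) (h.1 0 1) * hi }
  refine isCyclic_of_injective_ringHom F fun g h hgh => ?_
  change algebraMap k _ (g.1 0 0) + algebraMap k _ (g.1 0 1) * i =
    algebraMap k _ (h.1 0 0) + algebraMap k _ (h.1 0 1) * i at hgh
  have h01 : g.1 0 1 = h.1 0 1 := by
    by_contra hne
    have hne' : g.1 0 1 - h.1 0 1 ≠ 0 := sub_ne_zero.2 hne
    have hne'' : algebraMap k (AlgebraicClosure k) (g.1 0 1 - h.1 0 1) ≠ 0 := by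
      rwa [Ne, map_eq_zero]
    have hi' : i = algebraMap k _ ((h.1 0 0 - g.1 0 0) / (g.1 0 1 - h.1 0 1)) := by
      rw [map_div₀, eq_div_iff hne'']
      simp only [map_sub]
      linear_combination hgh
    refine hk ⟨(h.1 0 0 - g.1 0 0) / (g.1 0 1 - h.1 0 1), ?_⟩
    apply (algebraMap k (AlgebraicClosure k)).injective
    rw [map_mul, ← hi', map_neg, map_one, ← hi, sq]
  have h00 : g.1 0 0 = h.1 0 0 := by
    rw [h01] at hgh
    exact (algebraMap k (AlgebraicClosure k)).injective (add_right_cancel hgh)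
  refine Subtype.ext (SL2_eq_of_entries h00 h01 ?_ ?_)
  · rw [g.2.2, h.2.2, h01]
  · rw [g.2.1, h.2.1, h00]

theorem exists_mem_torusNormalizer_not_mem_normTorus [Finite k] (hk : ¬IsSquare (-1 : k)) :
    ∃ w ∈ torusNormalizer k, w ∉ normTorus k := by
  have h2 : (2 : k) ≠ 0 := fun h => hk ⟨1, by linear_combination -h⟩
  have : NeZero (ringChar k) := ⟨CharP.ringChar_ne_zero_of_finite k⟩
  obtain ⟨c, d, hcd⟩ := CharP.sq_add_sq k (ringChar k) (-1)
  push_cast at hcd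
  refine ⟨⟨!![(c : k), d; d, -c], ?_⟩, Or.inr ?_, ?_⟩
  · rw [det_fin_two_of]; linear_combination -hcd
  · simp
  · rintro ⟨h₁, h₂⟩
    have h₁' : -(c : k) = c := by simpa using h₁
    have h₂' : (d : k) = -d := by simpa using h₂
    have hc : (c : k) = 0 := by
      have : 2 * (c : k) = 0 := by linear_combination -h₁'
      exact (mul_eq_zero.1 this).resolve_left h2
    have hd : (d : k) = 0 := by
      have : 2 * (d : k) = 0 := by linear_combination h₂'
      exact (mul_eq_zero.1 this).resolve_left h2
    simp [hc, hd] at hcd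

theorem mul_mem_normTorus {x y : Matrix.SpecialLinearGroup (Fin 2) k}
    (hx : x ∈ torusNormalizer k) (hx' : x ∉ normTorus k) (hy : y ∈ torusNormalizer k)
    (hy' : y ∉ normTorus k) : x * y ∈ normTorus k := by
  obtain ⟨h₁, h₂⟩ := hx.resolve_left hx'
  obtain ⟨h₃, h₄⟩ := hy.resolve_left hy'
  rw [mem_normTorus]
  simp only [SL2_mul_apply, h₁, h₂, h₃, h₄]
  constructor <;> ring

theorem card_torusNormalizer [Finite k] (hk : ¬IsSquare (-1 : k)) :
    Nat.card (torusNormalizer k) = 2 * (Nat.card k + 1) := by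
  obtain ⟨w, hw, hw'⟩ := exists_mem_torusNormalizer_not_mem_normTorus hk
  have hidx : ((normTorus k).subgroupOf (torusNormalizer k)).index = 2 := by
    refine Subgroup.index_eq_two_iff.2 ⟨⟨w, hw⟩, fun b => ?_⟩
    simp only [Subgroup.mem_subgroupOf, Subgroup.coe_mul]
    by_cases hb : b.1 ∈ normTorus k
    · exact Or.inr ⟨hb, fun h => hw' ((Subgroup.mul_mem_cancel_left _ hb).1 h)⟩
    · exact Or.inl ⟨mul_mem_normTorus b.2 hb hw hw', hb⟩
  have hcard := Nat.card_congr (Subgroup.subgroupOfEquivOfLe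
    (normTorus_le_torusNormalizer (k := k))).toEquiv
  rw [← Subgroup.card_mul_index ((normTorus k).subgroupOf (torusNormalizer k)), hidx, hcard,
    card_normTorus hk, mul_comm]

theorem eq_one_or_neg_one_of_mul_self_eq_one (hk : ¬IsSquare (-1 : k))
    {t : Matrix.SpecialLinearGroup (Fin 2) k} (ht : t ∈ normTorus k) (h : t * t = 1) :
    t = 1 ∨ t = -1 := by
  have h2 : (2 : k) ≠ 0 := fun h => hk ⟨1, by linear_combination -h⟩
  have h₀ := SL2_mul_apply t t 0 0
  have h₁ := SL2_mul_apply t t 0 1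
  rw [h, ht.2] at h₀
  rw [h, ht.1] at h₁
  simp only [Matrix.SpecialLinearGroup.coe_one, one_apply_eq, ne_eq, zero_ne_one,
    not_false_eq_true, one_apply_ne] at h₀ h₁
  refine eq_one_or_neg_one_of_mem_torusNormalizer hk (normTorus_le_torusNormalizer ht) ?_
  have : 2 * (t 0 0 * t 0 1) = 0 := by linear_combination -h₁
  refine (mul_eq_zero.1 ((mul_eq_zero.1 this).resolve_left h2)).resolve_left fun h₃ => hk ?_
  exact ⟨t 0 1, by rw [h₃] at h₀; linear_combination -h₀⟩

theorem nonempty_map_torusNormalizer_mulEquiv_dihedralGroup [Finite k] (hk : ¬IsSquare (-1 : k))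
    {H : Type*} [Group H] (ψ : Matrix.SpecialLinearGroup (Fin 2) k →* H)
    (hψ : ∀ x, ψ x = 1 ↔ x = 1 ∨ x = -1) :
    Nonempty ((torusNormalizer k).map ψ ≃* DihedralGroup ((Nat.card k + 1) / 2)) := by
  obtain ⟨w, hw, hw'⟩ := exists_mem_torusNormalizer_not_mem_normTorus hk
  obtain ⟨⟨r, hr⟩, hgen⟩ := (isCyclic_normTorus hk).exists_generator
  have hgen' (t : Matrix.SpecialLinearGroup (Fin 2) k) (ht : t ∈ normTorus k) :
      ∃ i : ℤ, r ^ i = t := by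
    obtain ⟨i, hi⟩ := hgen ⟨t, ht⟩
    exact ⟨i, congrArg Subtype.val hi⟩
  have hord : orderOf r = Nat.card k + 1 := by
    rw [← card_normTorus hk, ← orderOf_eq_card_of_forall_mem_zpowers hgen, Subgroup.orderOf_mk]
  have hne : (-1 : Matrix.SpecialLinearGroup (Fin 2) k) ≠ 1 := fun h => by
    have h' : (-1 : k) = 1 := by
      have := congrArg (fun g : Matrix.SpecialLinearGroup (Fin 2) k => g 0 0) h
      simpa using this
    exact hk ⟨1, by rw [h', one_mul]⟩
  have hpow (i : ℕ) : ψ r ^ i = 1 ↔ orderOf r ∣ 2 * i := by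
    rw [← map_pow, hψ, orderOf_dvd_iff_pow_eq_one, mul_comm, pow_mul, sq]
    exact ⟨by rintro (h | h) <;> simp [h],
      eq_one_or_neg_one_of_mul_self_eq_one hk (pow_mem hr i)⟩
  obtain ⟨m, hm⟩ : Even (orderOf r) := by
    obtain ⟨i, hi⟩ := hgen' _ neg_one_mem_normTorus
    by_contra hodd
    rw [Nat.not_even_iff_odd] at hodd
    have h₁ : r ^ (i * orderOf r) = 1 := by
      rw [mul_comm, _root_.zpow_mul, zpow_natCast, pow_orderOf_eq_one, _root_.one_zpow]
    rw [_root_.zpow_mul, hi, zpow_natCast, hodd.neg_one_pow] at h₁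
    exact hne h₁
  have hm' : (Nat.card k + 1) / 2 = m := by omega
  rw [hm']
  have hww : w * w = -1 := by
    obtain ⟨h₁, h₂⟩ := hw.resolve_left hw'
    have hdet := SL2_det_eq w
    rw [h₁, h₂] at hdet
    apply SL2_eq_of_entries <;> simp only [SL2_mul_apply, h₁, h₂] <;> simp <;>
    first | linear_combination -hdet | ring
  have htw (t : Matrix.SpecialLinearGroup (Fin 2) k) (ht : t ∈ normTorus k) :
      t * w = w * t⁻¹ := by
    obtain ⟨h₁, h₂⟩ := hw.resolve_left hw'
    obtain ⟨h₃, h₄⟩ := ht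
    obtain ⟨e₁, e₂, e₃, e₄⟩ := SL2_inv_eq t
    apply SL2_eq_of_entries <;> simp only [SL2_mul_apply, e₁, e₂, e₃, e₄, h₁, h₂, h₃, h₄] <;> ring
  refine Subgroup.nonempty_mulEquiv_dihedralGroup _ (ρ := ψ r) (σ := ψ w)
    (Subgroup.mem_map_of_mem _ (normTorus_le_torusNormalizer hr)) (Subgroup.mem_map_of_mem _ hw)
    ?_ ?_ ?_ ?_ ?_
  · refine Nat.dvd_antisymm (orderOf_dvd_of_pow_eq_one ((hpow m).2 ?_)) ?_
    · rw [hm, two_mul]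
    · have := (hpow _).1 (pow_orderOf_eq_one (ψ r))
      rwa [hm, ← two_mul, Nat.mul_dvd_mul_iff_left two_pos] at this
  · rw [← map_mul, hψ, hww]
    exact Or.inr rfl
  · intro i
    rw [← map_zpow, ← map_zpow, ← map_mul, ← map_mul, htw _ (zpow_mem hr i), _root_.zpow_neg]
  · rintro ⟨i, hi⟩
    have h₁ : ψ (w⁻¹ * r ^ i) = 1 := by
      rw [map_mul, map_inv, map_zpow]
      exact inv_mul_eq_one.2 hi.symm
    have h₂ : w⁻¹ * r ^ i ∈ normTorus k := by
      rcases (hψ _).1 h₁ with h | h <;> rw [h]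
      exacts [one_mem _, neg_one_mem_normTorus]
    exact hw' (inv_mem_iff.1 ((Subgroup.mul_mem_cancel_right _ (zpow_mem hr i)).1 h₂))
  · rintro _ ⟨n, hn, rfl⟩
    by_cases hnT : n ∈ normTorus k
    · obtain ⟨i, rfl⟩ := hgen' n hnT
      exact Or.inl ⟨i, (map_zpow ψ r i).symm⟩
    · obtain ⟨i, hi⟩ := hgen' _ (mul_mem_normTorus hw hw' hn hnT)
      refine Or.inr ⟨i, ?_⟩
      rw [← map_mul, ← hi, map_zpow]

end NormTorus

section Amalgam

variable {G : Type*} [Group G] {A B Z : Subgroup G}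

/-- Nonempty reduced words of the amalgamated product of `A` and `B` over `Z` whose last letter
lies in `B`. -/
inductive AlternatingWord (A B Z : Subgroup G) : G → Prop
  | base {a b : G} (ha : a ∈ A) (hb : b ∈ B) (hb' : b ∉ Z) : AlternatingWord A B Z (a * b)
  | step {w a b : G} (hw : AlternatingWord A B Z w) (ha : a ∈ A) (ha' : a ∉ Z) (hb : b ∈ B)
      (hb' : b ∉ Z) : AlternatingWord A B Z (w * a * b)

theorem mem_or_exists_alternatingWord (hZA : Z ≤ A) (hZB : Z ≤ B) {g : G}
    (hg : g ∈ Subgroup.closure ((A : Set G) ∪ B)) :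
    g ∈ A ∨ ∃ w a, AlternatingWord A B Z w ∧ a ∈ A ∧ g = w * a := by
  have key (x y : G) (hy : y ∈ (A : Set G) ∪ B)
      (hx : x ∈ A ∨ ∃ w a, AlternatingWord A B Z w ∧ a ∈ A ∧ x = w * a) :
      x * y ∈ A ∨ ∃ w a, AlternatingWord A B Z w ∧ a ∈ A ∧ x * y = w * a := by
    rcases hy with hy | hy
    · rcases hx with hx | ⟨w, a, hw, ha, rfl⟩
      · exact Or.inl (mul_mem hx hy)
      · exact Or.inr ⟨w, a * y, hw, mul_mem ha hy, mul_assoc _ _ _⟩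
    · by_cases hyZ : y ∈ Z
      · rcases hx with hx | ⟨w, a, hw, ha, rfl⟩
        · exact Or.inl (mul_mem hx (hZA hyZ))
        · exact Or.inr ⟨w, a * y, hw, mul_mem ha (hZA hyZ), mul_assoc _ _ _⟩
      rcases hx with hx | ⟨w, a, hw, ha, rfl⟩
      · exact Or.inr ⟨x * y, 1, .base hx hy hyZ, one_mem _, (mul_one _).symm⟩
      by_cases haZ : a ∈ Z
      · rcases hw with ⟨ha₁, hb₁, hb₁'⟩ | @⟨w₁, a₁, b₁, hw₁, ha₁, ha₁', hb₁, hb₁'⟩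
        · rename_i a₁ b₁
          have hB : b₁ * a * y ∈ B := mul_mem (mul_mem hb₁ (hZB haZ)) hy
          have he : a₁ * b₁ * a * y = a₁ * (b₁ * a * y) := by simp only [mul_assoc]
          rw [he]
          by_cases hZ : b₁ * a * y ∈ Z
          · exact Or.inl (mul_mem ha₁ (hZA hZ))
          · exact Or.inr ⟨_, 1, .base ha₁ hB hZ, one_mem _, (mul_one _).symm⟩
        · have hB : b₁ * a * y ∈ B := mul_mem (mul_mem hb₁ (hZB haZ)) hy
          have he : w₁ * a₁ * b₁ * a * y = w₁ * a₁ * (b₁ * a * y) := by simp only [mul_assoc]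
          rw [he]
          by_cases hZ : b₁ * a * y ∈ Z
          · exact Or.inr ⟨w₁, _, hw₁, mul_mem ha₁ (hZA hZ), mul_assoc _ _ _⟩
          · exact Or.inr ⟨_, 1, .step hw₁ ha₁ ha₁' hB hZ, one_mem _, (mul_one _).symm⟩
      · exact Or.inr ⟨_, 1, .step hw ha haZ hy hyZ, one_mem _, (mul_one _).symm⟩
  induction hg using Subgroup.closure_induction_right with
  | one => exact Or.inl (one_mem _)
  | mul_right x hx y hy ih => exact key x y hy ih
  | mul_inv_cancel x hx y hy ih =>
    exact key x y⁻¹ (hy.imp (fun h => A.inv_mem h) (fun h => B.inv_mem h)) ih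

end Amalgam

section Topology

open Matrix WithZero

instance SL2.isTopologicalGroup (K : Type*) [Field K] [TopologicalSpace K] [IsTopologicalRing K] :
    IsTopologicalGroup (Matrix.SpecialLinearGroup (Fin 2) K) :=
  Matrix.SpecialLinearGroup.topologicalGroup

theorem SL2.isClosedEmbedding_coe (K : Type*) [Field K] [TopologicalSpace K]
    [IsTopologicalRing K] [T1Space K] : Topology.IsClosedEmbedding
      (fun g : Matrix.SpecialLinearGroup (Fin 2) K => (g : Matrix (Fin 2) (Fin 2) K)) := by
  refine ⟨⟨⟨rfl⟩, Subtype.val_injective⟩, ?_⟩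
  have : Set.range (fun g : Matrix.SpecialLinearGroup (Fin 2) K =>
      (g : Matrix (Fin 2) (Fin 2) K)) = det ⁻¹' {1} := by
    ext M
    exact ⟨by rintro ⟨g, rfl⟩; exact g.2, fun h => ⟨⟨M, h⟩, rfl⟩⟩
  rw [this]
  exact isClosed_singleton.preimage (continuous_id.matrix_det)

variable {k : Type*} [Field k]

theorem LaurentSeries.isCompact_valuation_le_one [Finite k] :
    IsCompact {f : LaurentSeries k | Valued.v f ≤ 1} := by
  let _ : TopologicalSpace k := ⊥
  have : DiscreteTopology k := ⟨rfl⟩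
  have hcont : Continuous fun c : ℕ → k =>
      ((PowerSeries.mk c : PowerSeries k) : LaurentSeries k) := by
    rw [continuous_iff_continuousAt]
    intro c U hU
    obtain ⟨γ, hγ⟩ := Valued.mem_nhds.1 hU
    set D := -(log (MonoidWithZeroHom.ValueGroup₀.embedding γ.1) - 1) with hD₀
    have hD : exp (-D) < MonoidWithZeroHom.ValueGroup₀.embedding γ.1 := by
      rw [← lt_log_iff_exp_lt (by simp), hD₀]
      simp
    have hopen : Set.pi (Finset.range D.toNat : Set ℕ) (fun n => {c n}) ∈ nhds c :=
      set_pi_mem_nhds (Finset.finite_toSet _) fun n _ => by simp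
    refine Filter.mem_map.2 (Filter.mem_of_superset hopen fun c' hc' => hγ ?_)
    rw [Set.mem_ofPred_eq, Valuation.restrict_lt_iff_lt_embedding]
    refine lt_of_le_of_lt ((valuation_le_iff_coeff_lt_eq_zero k).2 fun n hn => ?_) hD
    rw [← PowerSeries.coe_sub, PowerSeries.coeff_coe]
    split_ifs with h
    · rfl
    · have : c' n.natAbs = c n.natAbs := hc' _ (by
        simp only [Finset.coe_range, Set.mem_Iio]
        clear_value D
        omega)
      simp [this]
  convert isCompact_range hcont
  ext f
  rw [Set.mem_ofPred_eq, val_le_one_iff_eq_coe]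
  constructor
  · rintro ⟨F, rfl⟩
    exact ⟨fun n => PowerSeries.coeff n F,
      congrArg _ (PowerSeries.ext fun n => PowerSeries.coeff_mk _ _)⟩
  · rintro ⟨c, rfl⟩
    exact ⟨_, rfl⟩

/-- The matrices in `SL₂(k((u)))` with entries in `k[[u]]`. -/
def integralSL2 (k : Type*) [Field k] : Set (Matrix.SpecialLinearGroup (Fin 2) (LaurentSeries k)) :=
  {g | ∀ i j, Valued.v (g i j) ≤ 1}

theorem integralSL2_eq_preimage : integralSL2 k =
    (fun g : Matrix.SpecialLinearGroup (Fin 2) (LaurentSeries k) =>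
      (g : Matrix (Fin 2) (Fin 2) (LaurentSeries k))) ⁻¹'
      Set.pi Set.univ fun _ => Set.pi Set.univ fun _ => {f | Valued.v f ≤ 1} := by
  ext g
  exact ⟨fun h i _ j _ => h i j, fun h i j => h i trivial j trivial⟩

theorem isOpen_integralSL2 : IsOpen (integralSL2 k) := by
  rw [integralSL2_eq_preimage]
  refine IsOpen.preimage continuous_induced_dom ?_
  exact isOpen_set_pi Set.finite_univ fun _ _ => isOpen_set_pi Set.finite_univ fun _ _ =>
    (LaurentSeries.valued k).isOpen_integer

theorem isCompact_integralSL2 [Finite k] : IsCompact (integralSL2 k) := by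
  rw [integralSL2_eq_preimage]
  refine (SL2.isClosedEmbedding_coe _).isCompact_preimage ?_
  exact isCompact_univ_pi fun _ => isCompact_univ_pi fun _ =>
    LaurentSeries.isCompact_valuation_le_one

theorem integralSL2_mul {g h : Matrix.SpecialLinearGroup (Fin 2) (LaurentSeries k)}
    (hg : g ∈ integralSL2 k) (hh : h ∈ integralSL2 k) : g * h ∈ integralSL2 k := by
  intro i j
  rw [SL2_mul_apply]
  refine Valuation.map_add_le _ ?_ ?_ <;> rw [map_mul] <;> exact mul_le_one' (hg _ _) (hh _ _)

theorem discreteTopology_of_finite_inter_integralSL2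
    (Γ : Subgroup (Matrix.SpecialLinearGroup (Fin 2) (LaurentSeries k)))
    (h : ((Γ : Set _) ∩ integralSL2 k).Finite) : DiscreteTopology Γ := by
  have : T2Space (Matrix.SpecialLinearGroup (Fin 2) (LaurentSeries k)) :=
    (SL2.isClosedEmbedding_coe (LaurentSeries k)).isEmbedding.t2Space
  refine discreteTopology_of_isOpen_singleton_one ?_
  have h₁ : IsOpen ((↑) ⁻¹' integralSL2 k : Set Γ) :=
    isOpen_integralSL2.preimage continuous_subtype_val
  have h₂ : ((↑) ⁻¹' integralSL2 k : Set Γ).Finite := by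
    refine Set.Finite.of_finite_image (f := Subtype.val) (h.subset ?_) Subtype.val_injective.injOn
    rintro _ ⟨x, hx, rfl⟩
    exact ⟨x.2, hx⟩
  have h₃ : ((↑) ⁻¹' integralSL2 k \ {1} : Set Γ).Finite := h₂.subset Set.sdiff_subset
  convert h₁.sdiff h₃.isClosed
  rw [Set.sdiff_sdiff_cancel_left]
  rintro _ rfl i j
  rw [OneMemClass.coe_one, Matrix.SpecialLinearGroup.coe_one, one_apply]
  split_ifs <;> simp

theorem compactSpace_quotient_of_forall_exists_mul_mem_integralSL2 [Finite k]
    (Γ : Subgroup (Matrix.SpecialLinearGroup (Fin 2) (LaurentSeries k)))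
    (h : ∀ g, ∃ γ ∈ Γ, g * γ ∈ integralSL2 k) :
    CompactSpace (Matrix.SpecialLinearGroup (Fin 2) (LaurentSeries k) ⧸ Γ) := by
  refine ⟨?_⟩
  have := (isCompact_integralSL2 (k := k)).image
    (QuotientGroup.continuous_mk (N := Γ))
  convert this
  refine (Set.eq_univ_of_forall fun x => ?_).symm
  obtain ⟨g, rfl⟩ := QuotientGroup.mk_surjective x
  obtain ⟨γ, hγ, hg⟩ := h g
  exact ⟨_, hg, QuotientGroup.mk_mul_of_mem g hγ⟩

end Topology

section Lattice

open Matrix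

variable {k : Type*} [Field k]

/-- The entrywise inclusion of `SL₂(k)` in `SL₂(k((u)))`. -/
noncomputable def constSL2 (k : Type*) [Field k] :
    Matrix.SpecialLinearGroup (Fin 2) k →* Matrix.SpecialLinearGroup (Fin 2) (LaurentSeries k) :=
  Matrix.SpecialLinearGroup.map HahnSeries.C

/-- Conjugation by the diagonal matrix with entries `x` and `1`. -/
noncomputable def conjDiag {L : Type*} [Field L] {x : L} (hx : x ≠ 0) :
    Matrix.SpecialLinearGroup (Fin 2) L →* Matrix.SpecialLinearGroup (Fin 2) L where
  toFun g := ⟨!![g 0 0, x * g 0 1; x⁻¹ * g 1 0, g 1 1], by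
    rw [det_fin_two_of]
    linear_combination SL2_det_eq g - g 0 1 * g 1 0 * mul_inv_cancel₀ hx⟩
  map_one' := by apply SL2_eq_of_entries <;> simp
  map_mul' g h := by
    apply SL2_eq_of_entries <;> refine Eq.trans ?_ (SL2_mul_apply _ _ _ _).symm
    · change (g * h) 0 0 = g 0 0 * h 0 0 + x * g 0 1 * (x⁻¹ * h 1 0)
      rw [SL2_mul_apply]
      linear_combination -g 0 1 * h 1 0 * mul_inv_cancel₀ hx
    · change x * (g * h) 0 1 = g 0 0 * (x * h 0 1) + x * g 0 1 * h 1 1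
      rw [SL2_mul_apply]
      ring
    · change x⁻¹ * (g * h) 1 0 = x⁻¹ * g 1 0 * h 0 0 + g 1 1 * (x⁻¹ * h 1 0)
      rw [SL2_mul_apply]
      ring
    · change (g * h) 1 1 = x⁻¹ * g 1 0 * (x * h 0 1) + g 1 1 * h 1 1
      rw [SL2_mul_apply]
      linear_combination -g 1 0 * h 0 1 * mul_inv_cancel₀ hx

theorem LaurentSeries.single_one_one_ne_zero : (HahnSeries.single 1 1 : LaurentSeries k) ≠ 0 := by
  simp

/-- The conjugate by the diagonal matrix with entries `u` and `1` of the entrywise inclusion of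
`SL₂(k)` in `SL₂(k((u)))`. -/
noncomputable def twistSL2 (k : Type*) [Field k] :
    Matrix.SpecialLinearGroup (Fin 2) k →* Matrix.SpecialLinearGroup (Fin 2) (LaurentSeries k) :=
  (conjDiag LaurentSeries.single_one_one_ne_zero).comp (constSL2 k)

theorem constSL2_apply (g : Matrix.SpecialLinearGroup (Fin 2) k) (i j : Fin 2) :
    constSL2 k g i j = HahnSeries.C (g i j) := rfl

theorem twistSL2_apply (g : Matrix.SpecialLinearGroup (Fin 2) k) :
    twistSL2 k g 0 0 = HahnSeries.C (g 0 0) ∧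
    twistSL2 k g 0 1 = HahnSeries.single 1 1 * HahnSeries.C (g 0 1) ∧
    twistSL2 k g 1 0 = (HahnSeries.single 1 1)⁻¹ * HahnSeries.C (g 1 0) ∧
    twistSL2 k g 1 1 = HahnSeries.C (g 1 1) := ⟨rfl, rfl, rfl, rfl⟩

theorem constSL2_injective : Function.Injective (constSL2 k) := by
  intro g h hgh
  ext i j
  have := congrArg (fun x : Matrix.SpecialLinearGroup (Fin 2) (LaurentSeries k) => x i j) hgh
  exact HahnSeries.C_injective this

theorem conjDiag_injective {L : Type*} [Field L] {x : L} (hx : x ≠ 0) :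
    Function.Injective (conjDiag hx) := by
  intro g h hgh
  have key (i j : Fin 2) := congrArg (fun x : Matrix.SpecialLinearGroup (Fin 2) L => x i j) hgh
  exact SL2_eq_of_entries (key 0 0) (mul_left_cancel₀ hx (key 0 1))
    (mul_left_cancel₀ (inv_ne_zero hx) (key 1 0)) (key 1 1)

theorem twistSL2_injective : Function.Injective (twistSL2 k) :=
  (conjDiag_injective LaurentSeries.single_one_one_ne_zero).comp constSL2_injective

theorem constSL2_neg_one : constSL2 k (-1) = -1 := by
  apply SL2_eq_of_entries <;> simp [constSL2_apply]

theorem twistSL2_neg_one : twistSL2 k (-1) = -1 := by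
  obtain ⟨h₁, h₂, h₃, h₄⟩ := twistSL2_apply (-1 : Matrix.SpecialLinearGroup (Fin 2) k)
  apply SL2_eq_of_entries <;> simp [h₁, h₂, h₃, h₄]

theorem SL2_mem_center_iff {L : Type*} [Field L] {g : Matrix.SpecialLinearGroup (Fin 2) L} :
    g ∈ Subgroup.center (Matrix.SpecialLinearGroup (Fin 2) L) ↔ g = 1 ∨ g = -1 := by
  constructor
  · intro hg
    obtain ⟨r, hr, hrg⟩ := Matrix.SpecialLinearGroup.mem_center_iff.1 hg
    have hr' : r = 1 ∨ r = -1 := by simpa using hr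
    refine hr'.imp ?_ ?_ <;> rintro rfl <;> ext i j <;> rw [← hrg] <;>
      fin_cases i <;> fin_cases j <;> simp
  · rintro (rfl | rfl)
    · exact one_mem _
    · exact Subgroup.mem_center_iff.2 fun h => by simp

theorem mk_eq_one_iff_of_injective {L : Type*} [Field L]
    {φ : Matrix.SpecialLinearGroup (Fin 2) k →* Matrix.SpecialLinearGroup (Fin 2) L}
    (hφ : Function.Injective φ) (hneg : φ (-1) = -1) (x : Matrix.SpecialLinearGroup (Fin 2) k) :
    (QuotientGroup.mk' (Subgroup.center (Matrix.SpecialLinearGroup (Fin 2) L))).comp φ x = 1 ↔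
      x = 1 ∨ x = -1 := by
  rw [MonoidHom.comp_apply, QuotientGroup.mk'_apply, QuotientGroup.eq_one_iff, SL2_mem_center_iff,
    ← hneg, hφ.eq_iff, map_eq_one_iff φ hφ]

theorem card_map_torusNormalizer [Finite k] (hk : ¬IsSquare (-1 : k)) {H : Type*} [Group H]
    {φ : Matrix.SpecialLinearGroup (Fin 2) k →* H} (hφ : Function.Injective φ) :
    Nat.card ((torusNormalizer k).map φ) = 2 * (Nat.card k + 1) := by
  rw [← card_torusNormalizer hk,
    Nat.card_congr ((torusNormalizer k).equivMapOfInjective φ hφ).toEquiv]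

theorem finite_map_torusNormalizer [Finite k] (hk : ¬IsSquare (-1 : k)) {H : Type*} [Group H]
    {φ : Matrix.SpecialLinearGroup (Fin 2) k →* H} (hφ : Function.Injective φ) :
    Finite ((torusNormalizer k).map φ) :=
  Nat.finite_of_card_ne_zero (by rw [card_map_torusNormalizer hk hφ]; omega)

theorem LaurentSeries.valuation_single_one_one_lt_one :
    Valued.v (HahnSeries.single 1 1 : LaurentSeries k) < 1 := by
  rw [LaurentSeries.valuation_single_zpow, ← WithZero.exp_zero, WithZero.exp_lt_exp]
  norm_num

theorem LaurentSeries.valuation_C_le_one (c : k) :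
    Valued.v (HahnSeries.C c : LaurentSeries k) ≤ 1 :=
  (LaurentSeries.val_le_one_iff_eq_coe k _).2 ⟨PowerSeries.C c, by simp⟩

theorem LaurentSeries.valuation_C {c : k} (hc : c ≠ 0) :
    Valued.v (HahnSeries.C c : LaurentSeries k) = 1 := by
  refine le_antisymm (valuation_C_le_one c) ?_
  have h : Valued.v (HahnSeries.C c : LaurentSeries k) *
      Valued.v (HahnSeries.C c⁻¹ : LaurentSeries k) = 1 := by
    rw [← map_mul, ← map_mul, mul_inv_cancel₀ hc, map_one, map_one]
  rw [← h]
  exact mul_le_of_le_one_right' (valuation_C_le_one _)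

theorem PowerSeries.valuation_coe_le_one (f : PowerSeries k) :
    Valued.v (f : LaurentSeries k) ≤ 1 :=
  (LaurentSeries.val_le_one_iff_eq_coe k _).2 ⟨f, rfl⟩

theorem PowerSeries.constantCoeff_eq_zero_of_valuation_coe_lt_one {f : PowerSeries k}
    (h : Valued.v (f : LaurentSeries k) < 1) : PowerSeries.constantCoeff f = 0 := by
  by_contra hf
  have h₁ : Valued.v (f : LaurentSeries k) *
      Valued.v ((f⁻¹ : PowerSeries k) : LaurentSeries k) = 1 := by
    rw [← map_mul, ← PowerSeries.coe_mul, PowerSeries.mul_inv_cancel f hf, PowerSeries.coe_one,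
      map_one]
  exact absurd h₁ (mul_lt_one_of_lt_of_le h (valuation_coe_le_one _)).ne

theorem PowerSeries.valuation_coe_le_iff (f : PowerSeries k) :
    Valued.v (f : LaurentSeries k) ≤ Valued.v (HahnSeries.single 1 1 : LaurentSeries k) ↔
      PowerSeries.constantCoeff f = 0 := by
  refine ⟨fun h => constantCoeff_eq_zero_of_valuation_coe_lt_one
    (h.trans_lt LaurentSeries.valuation_single_one_one_lt_one), fun h => ?_⟩
  obtain ⟨g, rfl⟩ := PowerSeries.X_dvd_iff.2 h
  rw [PowerSeries.coe_mul, PowerSeries.coe_X, map_mul]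
  exact mul_le_of_le_one_right' (valuation_coe_le_one _)

theorem exists_const_combination_valuation_le {x y : Fin 2 → LaurentSeries k}
    (hx : ∀ i, Valued.v (x i) ≤ 1) (hy : ∀ i, Valued.v (y i) ≤ 1)
    (hdet : Valued.v (x 0 * y 1 - y 0 * x 1) < 1) :
    ∃ s t : k, (s ≠ 0 ∨ t ≠ 0) ∧ ∀ i, Valued.v (x i * HahnSeries.C s + y i * HahnSeries.C t) ≤
      Valued.v (HahnSeries.single 1 1 : LaurentSeries k) := by
  choose F hF using fun i => (LaurentSeries.val_le_one_iff_eq_coe k _).1 (hx i)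
  choose G hG using fun i => (LaurentSeries.val_le_one_iff_eq_coe k _).1 (hy i)
  obtain rfl : (fun i => (F i : LaurentSeries k)) = x := funext hF
  obtain rfl : (fun i => (G i : LaurentSeries k)) = y := funext hG
  simp only at hdet ⊢
  rw [← PowerSeries.coe_mul, ← PowerSeries.coe_mul, ← PowerSeries.coe_sub] at hdet
  have h := PowerSeries.constantCoeff_eq_zero_of_valuation_coe_lt_one hdet
  rw [map_sub, map_mul, map_mul] at h
  have key (s t : k) (i : Fin 2) : Valued.v ((F i : LaurentSeries k) * HahnSeries.C s +
      (G i : LaurentSeries k) * HahnSeries.C t) ≤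
        Valued.v (HahnSeries.single 1 1 : LaurentSeries k) ↔
      PowerSeries.constantCoeff (F i) * s + PowerSeries.constantCoeff (G i) * t = 0 := by
    rw [← PowerSeries.coe_C, ← PowerSeries.coe_C, ← PowerSeries.coe_mul, ← PowerSeries.coe_mul,
      ← PowerSeries.coe_add, PowerSeries.valuation_coe_le_iff, map_add, map_mul, map_mul,
      PowerSeries.constantCoeff_C, PowerSeries.constantCoeff_C]
  simp only [key, Fin.forall_fin_two]
  by_cases h₀ : PowerSeries.constantCoeff (G 0) ≠ 0 ∨ PowerSeries.constantCoeff (F 0) ≠ 0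
  · exact ⟨_, -_, h₀.imp_right neg_ne_zero.2, by ring, by linear_combination -h⟩
  by_cases h₁ : PowerSeries.constantCoeff (G 1) ≠ 0 ∨ PowerSeries.constantCoeff (F 1) ≠ 0
  · exact ⟨_, -_, h₁.imp_right neg_ne_zero.2, by linear_combination h, by ring⟩
  push Not at h₀ h₁
  exact ⟨1, 0, by simp, by simp [h₀], by simp [h₁]⟩

theorem exists_mem_torusNormalizer_proportional_left [Finite k] (hk : ¬IsSquare (-1 : k))
    {s t : k} (hst : s ≠ 0 ∨ t ≠ 0) :
    ∃ g ∈ torusNormalizer k, ∃ c, g 0 0 = c * s ∧ g 1 0 = c * t := by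
  obtain ⟨g, hg, c, h₁, h₂⟩ := exists_mem_torusNormalizer_proportional hk hst
  let J : Matrix.SpecialLinearGroup (Fin 2) k := ⟨!![0, -1; 1, 0], by simp⟩
  have hJ : J ∈ torusNormalizer k := normTorus_le_torusNormalizer (mem_normTorus.2 (by simp [J]))
  exact ⟨g * J, mul_mem hg hJ, c, by rw [SL2_mul_apply]; simp [J, h₁],
    by rw [SL2_mul_apply]; simp [J, h₂]⟩

/-- The subgroup of `SL₂(k((u)))` generated by the normalizer of the norm torus of `SL₂(k)` and by
its conjugate by the diagonal matrix with entries `u` and `1`. -/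
noncomputable def torusLattice (k : Type*) [Field k] :
    Subgroup (Matrix.SpecialLinearGroup (Fin 2) (LaurentSeries k)) :=
  Subgroup.closure (((torusNormalizer k).map (constSL2 k) : Set _) ∪
    (torusNormalizer k).map (twistSL2 k))

theorem constSL2_mem_torusLattice {g : Matrix.SpecialLinearGroup (Fin 2) k}
    (hg : g ∈ torusNormalizer k) : constSL2 k g ∈ torusLattice k :=
  Subgroup.subset_closure (Or.inl ⟨g, hg, rfl⟩)

theorem twistSL2_mem_torusLattice {g : Matrix.SpecialLinearGroup (Fin 2) k}
    (hg : g ∈ torusNormalizer k) : twistSL2 k g ∈ torusLattice k :=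
  Subgroup.subset_closure (Or.inr ⟨g, hg, rfl⟩)

theorem valuation_mul_C_add_mul_C_le {x y : LaurentSeries k} {r : WithZero (Multiplicative ℤ)}
    (hx : Valued.v x ≤ r) (hy : Valued.v y ≤ r) (s t : k) :
    Valued.v (x * HahnSeries.C s + y * HahnSeries.C t) ≤ r := by
  refine Valuation.map_add_le _ ?_ ?_ <;> rw [map_mul]
  · exact (mul_le_of_le_one_right' (LaurentSeries.valuation_C_le_one s)).trans hx
  · exact (mul_le_of_le_one_right' (LaurentSeries.valuation_C_le_one t)).trans hy

theorem exists_mem_torusLattice_mul_mem_integralSL2_of_valuation_le [Finite k]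
    (hk : ¬IsSquare (-1 : k)) (n : ℕ)
    (g : Matrix.SpecialLinearGroup (Fin 2) (LaurentSeries k))
    (hg : ∀ i j, Valued.v (HahnSeries.single 1 1 ^ n * g i j) ≤ 1) :
    ∃ γ ∈ torusLattice k, g * γ ∈ integralSL2 k := by
  induction n generalizing g with
  | zero => exact ⟨1, one_mem _, by simpa [integralSL2] using hg⟩
  | succ n ih =>
    set X : LaurentSeries k := HahnSeries.single 1 1 with hX
    have hX₀ : X ≠ 0 := LaurentSeries.single_one_one_ne_zero
    have hX₁ : Valued.v X < 1 := LaurentSeries.valuation_single_one_one_lt_one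
    have hdiv {f : LaurentSeries k} (hf : Valued.v f ≤ Valued.v X) : Valued.v (X⁻¹ * f) ≤ 1 := by
      rw [map_mul, map_inv₀]
      exact inv_mul_le_one_of_le₀ hf zero_le
    obtain ⟨s, t, hst, hst'⟩ := exists_const_combination_valuation_le
      (fun i => hg i 0) (fun i => hg i 1) (by
        have : X ^ (n + 1) * g 0 0 * (X ^ (n + 1) * g 1 1) -
            X ^ (n + 1) * g 0 1 * (X ^ (n + 1) * g 1 0) = X ^ (2 * n + 2) := by
          linear_combination X ^ (2 * n + 2) * SL2_det_eq g
        rw [this, map_pow]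
        exact pow_lt_one₀ zero_le hX₁ (by omega))
    obtain ⟨a, ha, c, hac₀, hac₁⟩ := exists_mem_torusNormalizer_proportional hk hst
    set h := g * constSL2 k a with hh
    have h₀ (i : Fin 2) : Valued.v (X ^ (n + 1) * h i 0) ≤ 1 := by
      rw [hh, SL2_mul_apply, constSL2_apply, constSL2_apply, mul_add, ← mul_assoc, ← mul_assoc]
      exact valuation_mul_C_add_mul_C_le (hg i 0) (hg i 1) _ _
    have h₁ (i : Fin 2) : Valued.v (X ^ n * h i 1) ≤ 1 := by
      have : X ^ n * h i 1 = X⁻¹ * (HahnSeries.C c * (X ^ (n + 1) * g i 0 * HahnSeries.C s +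
          X ^ (n + 1) * g i 1 * HahnSeries.C t)) := by
        rw [hh, SL2_mul_apply, constSL2_apply, constSL2_apply, hac₀, hac₁, map_mul, map_mul]
        linear_combination -X ^ n * HahnSeries.C c * (g i 0 * HahnSeries.C s +
          g i 1 * HahnSeries.C t) * inv_mul_cancel₀ hX₀
      rw [this]
      refine hdiv ?_
      rw [map_mul]
      exact (mul_le_of_le_one_left' (LaurentSeries.valuation_C_le_one c)).trans (hst' i)
    obtain ⟨s', t', hs, hs'⟩ := exists_const_combination_valuation_le h₀ h₁ (by
        have : X ^ (n + 1) * h 0 0 * (X ^ n * h 1 1) -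
            X ^ n * h 0 1 * (X ^ (n + 1) * h 1 0) = X ^ (2 * n + 1) := by
          linear_combination X ^ (2 * n + 1) * SL2_det_eq h
        rw [this, map_pow]
        exact pow_lt_one₀ zero_le hX₁ (by omega))
    obtain ⟨b, hb, d, hbd₀, hbd₁⟩ := exists_mem_torusNormalizer_proportional_left hk hs
    obtain ⟨e₁, e₂, e₃, e₄⟩ := twistSL2_apply b
    obtain ⟨γ, hγ, hγ'⟩ := ih (h * twistSL2 k b) (by
      intro i j
      rw [SL2_mul_apply]
      fin_cases j
      · simp only [Fin.zero_eta, e₁, e₃, ← hX, hbd₀, hbd₁]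
        have : X ^ n * (h i 0 * HahnSeries.C (d * s') + h i 1 * (X⁻¹ * HahnSeries.C (d * t'))) =
            X⁻¹ * (HahnSeries.C d * (X ^ (n + 1) * h i 0 * HahnSeries.C s' +
              X ^ n * h i 1 * HahnSeries.C t')) := by
          rw [map_mul, map_mul]
          linear_combination -X ^ n * HahnSeries.C d * h i 0 * HahnSeries.C s' *
            inv_mul_cancel₀ hX₀
        rw [this]
        refine hdiv ?_
        rw [map_mul]
        exact (mul_le_of_le_one_left' (LaurentSeries.valuation_C_le_one d)).trans (hs' i)
      · simp only [Fin.mk_one, e₂, e₄, ← hX]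
        have : X ^ n * (h i 0 * (X * HahnSeries.C (b 0 1)) + h i 1 * HahnSeries.C (b 1 1)) =
            X ^ (n + 1) * h i 0 * HahnSeries.C (b 0 1) + X ^ n * h i 1 * HahnSeries.C (b 1 1) := by
          ring
        rw [this]
        exact valuation_mul_C_add_mul_C_le (h₀ i) (h₁ i) _ _)
    refine ⟨constSL2 k a * twistSL2 k b * γ, mul_mem (mul_mem (constSL2_mem_torusLattice ha)
      (twistSL2_mem_torusLattice hb)) hγ, ?_⟩
    simpa only [hh, mul_assoc] using hγ'

theorem exists_mem_torusLattice_mul_mem_integralSL2 [Finite k] (hk : ¬IsSquare (-1 : k))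
    (g : Matrix.SpecialLinearGroup (Fin 2) (LaurentSeries k)) :
    ∃ γ ∈ torusLattice k, g * γ ∈ integralSL2 k := by
  have key (f : LaurentSeries k) : ∃ n : ℕ, ∀ m ≥ n,
      Valued.v (HahnSeries.single 1 1 ^ m * f) ≤ 1 := by
    obtain rfl | hf := eq_or_ne f 0
    · exact ⟨0, by simp⟩
    · refine ⟨(WithZero.log (Valued.v f)).toNat, fun m hm => ?_⟩
      have : Valued.v f = WithZero.exp (WithZero.log (Valued.v f)) :=
        (WithZero.exp_log ((Valuation.ne_zero_iff _).2 hf)).symm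
      rw [map_mul, map_pow, LaurentSeries.valuation_single_zpow, this, ← WithZero.exp_nsmul,
        ← WithZero.exp_add, ← WithZero.exp_zero, WithZero.exp_le_exp]
      simp only [smul_neg, nsmul_eq_mul, mul_one]
      omega
  choose n hn using fun i j => key (g i j)
  refine exists_mem_torusLattice_mul_mem_integralSL2_of_valuation_le hk
    (∑ i, ∑ j, n i j) g fun i j => hn i j _ ?_
  exact (Finset.single_le_sum (f := n i) (fun _ _ => Nat.zero_le _) (Finset.mem_univ j)).trans
    (Finset.single_le_sum (f := fun i => ∑ j, n i j) (fun _ _ => Nat.zero_le _) (Finset.mem_univ i))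

theorem apply_zero_one_ne_zero_of_constSL2_notMem (hk : ¬IsSquare (-1 : k))
    {g : Matrix.SpecialLinearGroup (Fin 2) k} (hg : g ∈ torusNormalizer k)
    (hZ : constSL2 k g ∉ (torusNormalizer k).map (constSL2 k) ⊓
      (torusNormalizer k).map (twistSL2 k)) : g 0 1 ≠ 0 := by
  refine fun h => hZ ⟨⟨g, hg, rfl⟩, g, hg, ?_⟩
  obtain rfl | rfl := eq_one_or_neg_one_of_mem_torusNormalizer hk hg h
  · rw [map_one, map_one]
  · rw [twistSL2_neg_one, constSL2_neg_one]

theorem apply_zero_one_ne_zero_of_twistSL2_notMem (hk : ¬IsSquare (-1 : k))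
    {g : Matrix.SpecialLinearGroup (Fin 2) k} (hg : g ∈ torusNormalizer k)
    (hZ : twistSL2 k g ∉ (torusNormalizer k).map (constSL2 k) ⊓
      (torusNormalizer k).map (twistSL2 k)) : g 0 1 ≠ 0 := by
  refine fun h => hZ ⟨⟨g, hg, ?_⟩, g, hg, rfl⟩
  obtain rfl | rfl := eq_one_or_neg_one_of_mem_torusNormalizer hk hg h
  · rw [map_one, map_one]
  · rw [twistSL2_neg_one, constSL2_neg_one]

theorem valuation_lt_valuation_mul_twistSL2
    {w : Matrix.SpecialLinearGroup (Fin 2) (LaurentSeries k)}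
    {i : Fin 2} (hw : Valued.v (w i 0) ≤ Valued.v (w i 1)) (hw' : 1 ≤ Valued.v (w i 1))
    {b : Matrix.SpecialLinearGroup (Fin 2) k} (hb : b 1 0 ≠ 0) :
    Valued.v ((w * twistSL2 k b) i 1) < Valued.v ((w * twistSL2 k b) i 0) ∧
      1 < Valued.v ((w * twistSL2 k b) i 0) := by
  obtain ⟨e₁, e₂, e₃, e₄⟩ := twistSL2_apply b
  set X : LaurentSeries k := HahnSeries.single 1 1 with hX
  have hX₁ : Valued.v X < 1 := LaurentSeries.valuation_single_one_one_lt_one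
  have hX₀ : 0 < Valued.v X := zero_lt_iff.2
    ((Valuation.ne_zero_iff _).2 LaurentSeries.single_one_one_ne_zero)
  have hpos : 0 < Valued.v (w i 1) := zero_lt_one.trans_le hw'
  have hlt : Valued.v (w i 1) < Valued.v (w i 1 * (X⁻¹ * HahnSeries.C (b 1 0))) := by
    rw [map_mul, map_mul, map_inv₀, LaurentSeries.valuation_C hb, mul_one]
    exact lt_mul_of_one_lt_right hpos ((one_lt_inv₀ hX₀).2 hX₁)
  have h₀ : Valued.v ((w * twistSL2 k b) i 0) =
      Valued.v (w i 1 * (X⁻¹ * HahnSeries.C (b 1 0))) := by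
    rw [SL2_mul_apply, e₁, e₃]
    refine Valuation.map_add_eq_of_lt_right _ (lt_of_le_of_lt ?_ hlt)
    rw [map_mul]
    exact (mul_le_of_le_one_right' (LaurentSeries.valuation_C_le_one _)).trans hw
  have h₁ : Valued.v ((w * twistSL2 k b) i 1) ≤ Valued.v (w i 1) := by
    rw [SL2_mul_apply, e₂, e₄, ← mul_assoc]
    refine valuation_mul_C_add_mul_C_le ?_ le_rfl _ _
    rw [map_mul]
    exact (mul_le_of_le_one_right' hX₁.le).trans hw
  rw [h₀]
  exact ⟨h₁.trans_lt hlt, hw'.trans_lt hlt⟩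

theorem valuation_mul_constSL2 {w : Matrix.SpecialLinearGroup (Fin 2) (LaurentSeries k)}
    {i : Fin 2} (hw : Valued.v (w i 1) < Valued.v (w i 0))
    {a : Matrix.SpecialLinearGroup (Fin 2) k} (ha : a 0 1 ≠ 0) :
    Valued.v ((w * constSL2 k a) i 0) ≤ Valued.v ((w * constSL2 k a) i 1) ∧
      Valued.v ((w * constSL2 k a) i 1) = Valued.v (w i 0) := by
  have h₁ : Valued.v ((w * constSL2 k a) i 1) = Valued.v (w i 0) := by
    have h : Valued.v (w i 0 * HahnSeries.C (a 0 1)) = Valued.v (w i 0) := by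
      rw [map_mul, LaurentSeries.valuation_C ha, mul_one]
    rw [SL2_mul_apply, constSL2_apply, constSL2_apply, ← h]
    refine Valuation.map_add_eq_of_lt_left _ (lt_of_le_of_lt ?_ (hw.trans_eq h.symm))
    rw [map_mul]
    exact mul_le_of_le_one_right' (LaurentSeries.valuation_C_le_one _)
  refine ⟨?_, h₁⟩
  rw [h₁, SL2_mul_apply]
  exact valuation_mul_C_add_mul_C_le le_rfl hw.le _ _

theorem AlternatingWord.exists_valuation_lt (hk : ¬IsSquare (-1 : k))
    {w : Matrix.SpecialLinearGroup (Fin 2) (LaurentSeries k)}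
    (hw : AlternatingWord ((torusNormalizer k).map (constSL2 k))
      ((torusNormalizer k).map (twistSL2 k))
      ((torusNormalizer k).map (constSL2 k) ⊓ (torusNormalizer k).map (twistSL2 k)) w) :
    ∃ i, Valued.v (w i 1) < Valued.v (w i 0) ∧ 1 < Valued.v (w i 0) := by
  induction hw with
  | base ha hb hb' =>
    obtain ⟨a, -, rfl⟩ := ha
    obtain ⟨b, hbN, rfl⟩ := hb
    have hb₁ := mt (torusNormalizer_apply_one_zero_eq_zero_iff hbN).1
      (apply_zero_one_ne_zero_of_twistSL2_notMem hk hbN hb')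
    obtain ⟨i, hi⟩ : ∃ i, a i 1 ≠ 0 := by
      by_contra! h
      simpa [h] using SL2_det_eq a
    have hi' : Valued.v (constSL2 k a i 1) = 1 := by
      rw [constSL2_apply, LaurentSeries.valuation_C hi]
    refine ⟨i, valuation_lt_valuation_mul_twistSL2 ?_ hi'.ge hb₁⟩
    rw [hi', constSL2_apply]
    exact LaurentSeries.valuation_C_le_one _
  | step hw ha ha' hb hb' ih =>
    obtain ⟨i, hi₁, hi₂⟩ := ih
    obtain ⟨a, haN, rfl⟩ := ha
    obtain ⟨b, hbN, rfl⟩ := hb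
    have hb₁ := mt (torusNormalizer_apply_one_zero_eq_zero_iff hbN).1
      (apply_zero_one_ne_zero_of_twistSL2_notMem hk hbN hb')
    obtain ⟨h₁, h₂⟩ := valuation_mul_constSL2 hi₁
      (apply_zero_one_ne_zero_of_constSL2_notMem hk haN ha')
    exact ⟨i, valuation_lt_valuation_mul_twistSL2 h₁ (hi₂.le.trans_eq h₂.symm) hb₁⟩

theorem constSL2_mem_integralSL2 (g : Matrix.SpecialLinearGroup (Fin 2) k) :
    constSL2 k g ∈ integralSL2 k := fun _ _ => LaurentSeries.valuation_C_le_one _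

theorem torusLattice_inter_integralSL2_subset (hk : ¬IsSquare (-1 : k)) :
    (torusLattice k : Set _) ∩ integralSL2 k ⊆ (torusNormalizer k).map (constSL2 k) := by
  rintro g ⟨hg, hgI⟩
  obtain hg | ⟨w, _, hw, ⟨a, ha, rfl⟩, rfl⟩ :=
    mem_or_exists_alternatingWord inf_le_left inf_le_right hg
  · exact hg
  · obtain ⟨i, -, hi⟩ := hw.exists_valuation_lt hk
    have := integralSL2_mul hgI (constSL2_mem_integralSL2 a⁻¹)
    rw [map_inv, mul_inv_cancel_right] at this
    exact absurd (this i 0) hi.not_ge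

theorem discreteTopology_torusLattice [Finite k] (hk : ¬IsSquare (-1 : k)) :
    DiscreteTopology (torusLattice k) :=
  discreteTopology_of_finite_inter_integralSL2 _
    (Set.Finite.subset (finite_map_torusNormalizer hk constSL2_injective)
      (torusLattice_inter_integralSL2_subset hk))

theorem coe_map_constSL2_inf_map_twistSL2 (hk : ¬IsSquare (-1 : k)) :
    (((torusNormalizer k).map (constSL2 k) ⊓ (torusNormalizer k).map (twistSL2 k) :
        Subgroup (Matrix.SpecialLinearGroup (Fin 2) (LaurentSeries k))) :
      Set (Matrix.SpecialLinearGroup (Fin 2) (LaurentSeries k))) = {1, -1} := by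
  have hneg := normTorus_le_torusNormalizer (neg_one_mem_normTorus (k := k))
  ext g
  constructor
  · rintro ⟨⟨a, ha, rfl⟩, b, hb, hab⟩
    have h : (HahnSeries.single 1 1 : LaurentSeries k) * HahnSeries.C (b 0 1) =
        HahnSeries.C (a 0 1) := congrArg
      (fun x : Matrix.SpecialLinearGroup (Fin 2) (LaurentSeries k) => x 0 1) hab
    have hv : Valued.v (HahnSeries.C (a 0 1) : LaurentSeries k) < 1 := by
      rw [← h, map_mul]
      exact mul_lt_one_of_lt_of_le LaurentSeries.valuation_single_one_one_lt_one
        (LaurentSeries.valuation_C_le_one _)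
    have ha₀ : a 0 1 = 0 := by
      by_contra ha₀
      exact hv.ne (LaurentSeries.valuation_C ha₀)
    obtain rfl | rfl := eq_one_or_neg_one_of_mem_torusNormalizer hk ha ha₀
    · exact Or.inl (map_one _)
    · exact Or.inr constSL2_neg_one
  · rintro (rfl | rfl)
    · exact one_mem _
    · exact ⟨⟨-1, hneg, constSL2_neg_one⟩, -1, hneg, twistSL2_neg_one⟩

end Lattice

/-- Let `p` be an odd prime, `q = p^a ≡ 3 (mod 4)`, `K = 𝔽_q((u))`.
Then there are finite subgroups `A₁, A₂ ≤ SL₂(K)` of order `2(q+1)` containing `-I`, with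
`A_i/⟨-I⟩` (i.e. the image of `A_i` in `SL₂(K)` modulo its centre, which is `⟨-I⟩`)
dihedral of order `q + 1`, `A₁ ∩ A₂ = {I, -I}`, and the subgroup generated by `A₁ ∪ A₂`
discrete and cocompact in `SL₂(K)`. -/
theorem exists_edge_transitive_lattice_q_three_mod_four (p a : ℕ) [Fact p.Prime]
    (hodd : Odd p) (ha : 1 ≤ a) (hq : p ^ a % 4 = 3) :
    ∃ A₁ A₂ : Subgroup (Matrix.SpecialLinearGroup (Fin 2)
        (LaurentSeries (GaloisField p a))),
      Finite A₁ ∧ Finite A₂ ∧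
      Nat.card A₁ = 2 * (p ^ a + 1) ∧ Nat.card A₂ = 2 * (p ^ a + 1) ∧
      (-1 : Matrix.SpecialLinearGroup (Fin 2) (LaurentSeries (GaloisField p a))) ∈ A₁ ∧
      (-1 : Matrix.SpecialLinearGroup (Fin 2) (LaurentSeries (GaloisField p a))) ∈ A₂ ∧
      Nonempty ((A₁.map (QuotientGroup.mk' (Subgroup.center
          (Matrix.SpecialLinearGroup (Fin 2) (LaurentSeries (GaloisField p a)))))) ≃*
        DihedralGroup ((p ^ a + 1) / 2)) ∧
      Nonempty ((A₂.map (QuotientGroup.mk' (Subgroup.center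
          (Matrix.SpecialLinearGroup (Fin 2) (LaurentSeries (GaloisField p a)))))) ≃*
        DihedralGroup ((p ^ a + 1) / 2)) ∧
      (↑(A₁ ⊓ A₂) : Set (Matrix.SpecialLinearGroup (Fin 2)
          (LaurentSeries (GaloisField p a)))) = {1, -1} ∧
      DiscreteTopology (Subgroup.closure ((↑A₁ ∪ ↑A₂) : Set (Matrix.SpecialLinearGroup
          (Fin 2) (LaurentSeries (GaloisField p a))))) ∧
      CompactSpace (Matrix.SpecialLinearGroup (Fin 2) (LaurentSeries (GaloisField p a)) ⧸
        Subgroup.closure ((↑A₁ ∪ ↑A₂) : Set (Matrix.SpecialLinearGroup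
          (Fin 2) (LaurentSeries (GaloisField p a))))) := by
  have : Finite (GaloisField p a) := inferInstance
  have hcard : Nat.card (GaloisField p a) = p ^ a := GaloisField.card p a (by omega)
  have hk : ¬IsSquare (-1 : GaloisField p a) := by
    have := Fintype.ofFinite (GaloisField p a)
    rw [FiniteField.isSquare_neg_one_iff, ← Nat.card_eq_fintype_card, hcard]
    exact not_not.2 hq
  have hneg := normTorus_le_torusNormalizer (neg_one_mem_normTorus (k := GaloisField p a))
  refine ⟨(torusNormalizer _).map (constSL2 _), (torusNormalizer _).map (twistSL2 _),
    finite_map_torusNormalizer hk constSL2_injective,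
    finite_map_torusNormalizer hk twistSL2_injective, ?_, ?_, ⟨-1, hneg, constSL2_neg_one⟩,
    ⟨-1, hneg, twistSL2_neg_one⟩, ?_, ?_, coe_map_constSL2_inf_map_twistSL2 hk,
    discreteTopology_torusLattice hk,
    compactSpace_quotient_of_forall_exists_mul_mem_integralSL2 _
      (exists_mem_torusLattice_mul_mem_integralSL2 hk)⟩
  · rw [card_map_torusNormalizer hk constSL2_injective, hcard]
  · rw [card_map_torusNormalizer hk twistSL2_injective, hcard]
  · rw [Subgroup.map_map, ← hcard]
    exact nonempty_map_torusNormalizer_mulEquiv_dihedralGroup hk _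
      (mk_eq_one_iff_of_injective constSL2_injective constSL2_neg_one)
  · rw [Subgroup.map_map, ← hcard]
    exact nonempty_map_torusNormalizer_mulEquiv_dihedralGroup hk _
      (mk_eq_one_iff_of_injective twistSL2_injective twistSL2_neg_one)
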